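/- Let 0 < α < 1, let t > 0, and let φ, ϕ : ℝ → ℝ be continuously differentiable on [0, t]. Define the left Riemann–Liouville fractional derivatives (D^{1−α}φ)(s) = (1/Γ(α)) · d/ds ∫₀ˢ φ(r)(s − r)^{α−1} dr and (D^{α}ϕ)(s) = (1/Γ(1−α)) · d/ds ∫₀ˢ ϕ(r)(s − r)^{−α} dr for 0 < s ≤ t. Then the fractional integration-by-parts formula holds: ∫₀ᵗ (D^{1−α}φ)(τ) · (D^{α}ϕ)(t − τ) dτ = ∫₀ᵗ φ′(τ) · ϕ(t − τ) dτ + φ(0)·ϕ(t). -/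

import Mathlib

open MeasureTheory

namespace FractionalCalculus

open Set ContinuousLinearMap Filter Topology

/-- Convolution of real functions on the line. -/
local notation:67 f:68 " ⋆ᵣ " g:67 => convolution f g (mul ℝ ℝ) volume

lemma convolutionExistsAt_of_bounded {f g : ℝ → ℝ} {M : ℝ} (hf : AEStronglyMeasurable f volume)
    (hM : ∀ x, |f x| ≤ M) (hg : Integrable g volume) (x : ℝ) :
    ConvolutionExistsAt f g x (mul ℝ ℝ) volume :=
  (hg.comp_sub_left x).bdd_mul hf (ae_of_all _ hM)

lemma abs_convolution_le_of_bounded {f g : ℝ → ℝ} {M : ℝ}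
    (hM : ∀ x, |f x| ≤ M) (hg : Integrable g volume) (x : ℝ) :
    |(f ⋆ᵣ g) x| ≤ M * ∫ u, |g u| := by
  calc |(f ⋆ᵣ g) x| ≤ ∫ u, M * |g (x - u)| := by
        rw [← Real.norm_eq_abs, convolution_def]
        refine norm_integral_le_of_norm_le ((hg.comp_sub_left x).abs.const_mul M)
          (ae_of_all _ fun u => ?_)
        simp only [mul_apply', Real.norm_eq_abs, abs_mul]
        exact mul_le_mul_of_nonneg_right (hM u) (abs_nonneg _)
    _ = M * ∫ u, |g u| := by
        rw [integral_const_mul, integral_sub_left_eq_self (fun u => |g u|)]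

lemma convolution_mul_comm (f g : ℝ → ℝ) : (f ⋆ᵣ g) = g ⋆ᵣ f := by
  have h : (mul ℝ ℝ).flip = mul ℝ ℝ := by ext; simp
  have := convolution_flip (f := f) (g := g) (L := mul ℝ ℝ) (μ := volume)
  rw [h] at this
  exact this.symm

lemma convolution_assoc_of_bounded {f g k : ℝ → ℝ} {M : ℝ} (hf : Integrable f volume)
    (hM : ∀ x, |f x| ≤ M) (hg : Integrable g volume) (hk : Integrable k volume) :
    ((f ⋆ᵣ g) ⋆ᵣ k) = f ⋆ᵣ (g ⋆ᵣ k) := by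
  funext x
  refine convolution_assoc _ _ _ _ (fun a b c => mul_assoc a b c) hf.1 hg.1 hk.1
    (hf.ae_convolution_exists _ hg) (hg.norm.ae_convolution_exists _ hk.norm) ?_
  exact convolutionExistsAt_of_bounded hf.1.norm (fun x => by simpa using hM x)
    (hg.norm.integrable_convolution _ hk.norm) x

lemma convolution_eq_setIntegral {f g : ℝ → ℝ} (hf : ∀ x ≤ 0, f x = 0) (hg : ∀ x ≤ 0, g x = 0)
    (x : ℝ) : (f ⋆ᵣ g) x = ∫ u in Ioo 0 x, f u * g (x - u) := by
  refine (setIntegral_eq_integral_of_forall_compl_eq_zero fun u hu => ?_).symm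
  by_cases h : 0 < u
  · rw [mul_apply', hg (x - u) (by by_contra hc; exact hu ⟨h, by linarith⟩), mul_zero]
  · rw [mul_apply', hf u (not_lt.1 h), zero_mul]

lemma convolution_eq_zero {f g : ℝ → ℝ} (hf : ∀ x ≤ 0, f x = 0) (hg : ∀ x ≤ 0, g x = 0)
    (x : ℝ) (hx : x ≤ 0) : (f ⋆ᵣ g) x = 0 := by
  rw [convolution_eq_setIntegral hf hg, Ioo_eq_empty (not_lt.2 hx), setIntegral_empty]

lemma indicator_Ioo_eq_zero (f : ℝ → ℝ) (t x : ℝ) (hx : x ≤ 0) : (Ioo 0 t).indicator f x = 0 :=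
  indicator_of_notMem (fun h => absurd h.1 (not_lt.2 hx)) _

lemma integrable_indicator_rpow {b : ℝ} (hb : -1 < b) (t : ℝ) :
    Integrable ((Ioo 0 t).indicator fun x : ℝ => x ^ b) volume := by
  rw [integrable_indicator_iff measurableSet_Ioo]
  rcases le_total 0 t with ht | ht
  · exact ((intervalIntegrable_iff_integrableOn_Ioo_of_le ht).1
      (intervalIntegral.intervalIntegrable_rpow' hb))
  · simp [Ioo_eq_empty (not_lt.2 ht)]

lemma integral_rpow_mul_rpow_complementary {α x : ℝ} (hα0 : 0 < α) (hα1 : α < 1) (hx : 0 < x) :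
    ∫ u in Ioo 0 x, u ^ (α - 1) * (x - u) ^ (-α) = Real.Gamma α * Real.Gamma (1 - α) := by
  have h := Complex.betaIntegral_scaled (α : ℂ) ((1 - α : ℝ) : ℂ) hx
  rw [Complex.betaIntegral_eq_Gamma_mul_div _ _ (by simpa) (by simpa),
    intervalIntegral.integral_of_le hx.le, integral_Ioc_eq_integral_Ioo] at h
  apply Complex.ofReal_injective
  rw [← integral_complex_ofReal]
  have h1 : ((α : ℂ) + ((1 - α : ℝ) : ℂ)) = 1 := by push_cast; ring
  rw [h1, sub_self, Complex.cpow_zero, one_mul, Complex.Gamma_one, div_one, Complex.Gamma_ofReal,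
    Complex.Gamma_ofReal, ← Complex.ofReal_mul] at h
  rw [← h]
  refine setIntegral_congr_fun measurableSet_Ioo fun u hu => ?_
  rw [Complex.ofReal_mul, Complex.ofReal_cpow hu.1.le, Complex.ofReal_cpow (sub_nonneg.2 hu.2.le)]
  push_cast
  ring_nf

lemma convolution_indicator_rpow {α t x : ℝ} (hα0 : 0 < α) (hα1 : α < 1) (hx : 0 < x)
    (hxt : x ≤ t) :
    (((Ioo 0 t).indicator fun y : ℝ => y ^ (α - 1)) ⋆ᵣ (Ioo 0 t).indicator fun y : ℝ => y ^ (-α)) x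
      = Real.Gamma α * Real.Gamma (1 - α) := by
  rw [convolution_eq_setIntegral (indicator_Ioo_eq_zero _ t) (indicator_Ioo_eq_zero _ t),
    ← integral_rpow_mul_rpow_complementary hα0 hα1 hx]
  refine setIntegral_congr_fun measurableSet_Ioo fun u hu => ?_
  rw [indicator_of_mem (show u ∈ Ioo 0 t from ⟨hu.1, hu.2.trans_le hxt⟩),
    indicator_of_mem (show x - u ∈ Ioo 0 t from ⟨sub_pos.2 hu.2, by linarith [hu.1]⟩)]

section ContDiffOn

variable {f : ℝ → ℝ} {t : ℝ}

lemma hasDerivAt_of_contDiffOn_Icc (hf : ContDiffOn ℝ 1 f (Icc 0 t)) {x : ℝ} (hx : x ∈ Ioo 0 t) :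
    HasDerivAt f (deriv f x) x :=
  ((hf.differentiableOn one_ne_zero).differentiableAt (Icc_mem_nhds hx.1 hx.2)).hasDerivAt

lemma exists_abs_indicator_deriv_le (hf : ContDiffOn ℝ 1 f (Icc 0 t)) (ht : 0 < t) :
    ∃ M, ∀ x, |(Ioo 0 t).indicator (deriv f) x| ≤ M := by
  have hc : ContinuousOn (derivWithin f (Icc 0 t)) (Icc 0 t) :=
    hf.continuousOn_derivWithin (uniqueDiffOn_Icc ht) le_rfl
  obtain ⟨M, hM⟩ := isCompact_Icc.exists_bound_of_continuousOn hc
  refine ⟨M, fun x => ?_⟩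
  by_cases hx : x ∈ Ioo 0 t
  · rw [indicator_of_mem hx, ← derivWithin_of_mem_nhds (Icc_mem_nhds hx.1 hx.2)]
    exact hM x (Ioo_subset_Icc_self hx)
  · rw [indicator_of_notMem hx, abs_zero]
    exact (norm_nonneg _).trans (hM 0 ⟨le_rfl, ht.le⟩)

lemma integrable_indicator_deriv (hf : ContDiffOn ℝ 1 f (Icc 0 t)) (ht : 0 < t) :
    Integrable ((Ioo 0 t).indicator (deriv f)) volume := by
  obtain ⟨M, hM⟩ := exists_abs_indicator_deriv_le hf ht
  rw [integrable_indicator_iff measurableSet_Ioo]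
  refine IntegrableOn.of_bound (by simp) (measurable_deriv f).aestronglyMeasurable M ?_
  refine (ae_restrict_iff' measurableSet_Ioo).2 (ae_of_all _ fun x hx => ?_)
  simpa [indicator_of_mem hx] using hM x

lemma setIntegral_deriv_eq_sub (hf : ContDiffOn ℝ 1 f (Icc 0 t)) {x : ℝ} (hx : 0 < x)
    (hxt : x ≤ t) : ∫ u in Ioo 0 x, deriv f u = f x - f 0 := by
  have hf' := hf.mono (Icc_subset_Icc_right hxt)
  rw [← integral_Ioc_eq_integral_Ioo, ← intervalIntegral.integral_of_le hx.le]
  refine intervalIntegral.integral_eq_sub_of_hasDerivAt_of_le hx.le hf'.continuousOn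
    (fun y hy => hasDerivAt_of_contDiffOn_Icc hf' hy) ?_
  rw [intervalIntegrable_iff_integrableOn_Ioo_of_le hx.le]
  exact (integrable_indicator_iff measurableSet_Ioo).1 (integrable_indicator_deriv hf' hx)

lemma continuousAt_indicator_deriv (hf : ContDiffOn ℝ 1 f (Icc 0 t)) {x : ℝ} (h0 : x ≠ 0)
    (hxt : x ≠ t) : ContinuousAt ((Ioo 0 t).indicator (deriv f)) x := by
  by_cases hx : x ∈ Ioo 0 t
  · have hc : ContinuousAt (deriv f) x :=
      ((hf.mono Ioo_subset_Icc_self).continuousOn_deriv_of_isOpen isOpen_Ioo le_rfl).continuousAt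
        (isOpen_Ioo.mem_nhds hx)
    refine hc.congr ?_
    filter_upwards [isOpen_Ioo.mem_nhds hx] with y hy
    rw [indicator_of_mem hy]
  · have hm : x ∈ (Icc 0 t)ᶜ := fun h => hx ⟨h.1.lt_of_ne' h0, h.2.lt_of_ne hxt⟩
    refine (continuousAt_const (y := (0 : ℝ))).congr ?_
    filter_upwards [isClosed_Icc.isOpen_compl.mem_nhds hm] with y hy
    rw [indicator_of_notMem fun h => hy (Ioo_subset_Icc_self h)]

lemma continuous_convolution_indicator_deriv (hf : ContDiffOn ℝ 1 f (Icc 0 t)) (ht : 0 < t)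
    {k : ℝ → ℝ} (hk : Integrable k volume) :
    Continuous ((Ioo 0 t).indicator (deriv f) ⋆ᵣ k) := by
  obtain ⟨M, hM⟩ := exists_abs_indicator_deriv_le hf ht
  rw [convolution_mul_comm, continuous_iff_continuousAt]
  intro x
  refine continuousAt_of_dominated (bound := fun u => |k u| * M) (Eventually.of_forall fun y => ?_)
    (Eventually.of_forall fun y => ae_of_all _ fun u => ?_) (hk.abs.mul_const M) ?_
  · exact hk.1.mul ((integrable_indicator_deriv hf ht).comp_sub_left y).1
  · simp only [mul_apply', Real.norm_eq_abs, abs_mul]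
    exact mul_le_mul_of_nonneg_left (hM _) (abs_nonneg _)
  · have h : ∀ᵐ u ∂(volume : Measure ℝ), u ∉ ({x, x - t} : Set ℝ) :=
      (measure_eq_zero_iff_ae_notMem).1 ((toFinite _).measure_zero _)
    filter_upwards [h] with u hu
    simp only [mem_insert_iff, mem_singleton_iff, not_or] at hu
    have hc := continuousAt_indicator_deriv hf (x := x - u) (fun h => hu.1 (by linarith))
      (fun h => hu.2 (by linarith))
    exact continuousAt_const.mul
      (ContinuousAt.comp (f := fun y => y - u) hc (by fun_prop))

/-- The Riemann-Liouville derivative of a `C¹` function is its Caputo derivative plus a boundary term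
(up to normalization). -/
lemma hasDerivAt_fractional_integral (hf : ContDiffOn ℝ 1 f (Icc 0 t)) {b : ℝ} (hb : -1 < b)
    {s : ℝ} (hs : s ∈ Ioo 0 t) :
    HasDerivAt (fun s : ℝ => ∫ r in Ioo 0 s, f r * (s - r) ^ b)
      (((f 0 • (Ioo 0 t).indicator fun x : ℝ => x ^ b) +
        ((Ioo 0 t).indicator (deriv f) ⋆ᵣ (Ioo 0 t).indicator fun x : ℝ => x ^ b)) s) s := by
  have ht : 0 < t := hs.1.trans hs.2
  set F := (Ioo 0 t).indicator (deriv f) with hF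
  set K := (Ioo 0 t).indicator fun x : ℝ => x ^ b with hK
  set H := (Ioo 0 t).indicator fun _ : ℝ => (1 : ℝ) with hH
  have hF0 : ∀ x ≤ 0, F x = 0 := indicator_Ioo_eq_zero _ t
  have hK0 : ∀ x ≤ 0, K x = 0 := indicator_Ioo_eq_zero _ t
  have hH0 : ∀ x ≤ 0, H x = 0 := indicator_Ioo_eq_zero _ t
  have hHb : ∀ x, |H x| ≤ 1 := fun x => by
    by_cases hx : x ∈ Ioo 0 t <;> simp [hH, hx]
  have hFi : Integrable F volume := integrable_indicator_deriv hf ht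
  have hKi : Integrable K volume := integrable_indicator_rpow hb t
  have hHi : Integrable H volume :=
    (integrable_indicator_iff measurableSet_Ioo).2 (integrableOn_const (by simp))
  have hFK : Integrable (F ⋆ᵣ K) volume := hFi.integrable_convolution _ hKi
  set g := f 0 • K + (F ⋆ᵣ K) with hg
  have hgi : Integrable g volume := (hKi.smul (f 0)).add hFK
  have hg0 : ∀ x ≤ 0, g x = 0 := fun x hx => by
    simp [hg, hK0 x hx, convolution_eq_zero hF0 hK0 x hx]
  have hrep : ∀ x ∈ Ioo 0 t, f x = (f 0 • H + (H ⋆ᵣ F)) x := fun x hx => by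
    have h1 : (H ⋆ᵣ F) x = f x - f 0 := by
      rw [convolution_mul_comm, convolution_eq_setIntegral hF0 hH0,
        ← setIntegral_deriv_eq_sub hf hx.1 hx.2.le]
      refine setIntegral_congr_fun measurableSet_Ioo fun u hu => ?_
      simp only [hF, hH]
      rw [indicator_of_mem (show u ∈ Ioo 0 t from ⟨hu.1, hu.2.trans hx.2⟩),
        indicator_of_mem (show x - u ∈ Ioo 0 t from
            ⟨sub_pos.2 hu.2, by linarith [hu.1, hx.2]⟩), mul_one]
    simp only [Pi.add_apply, Pi.smul_apply] at h1 ⊢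
    rw [h1, hH, indicator_of_mem hx]
    simp
  have hHF0 := convolution_eq_zero hH0 hF0
  have key : ∀ x ∈ Ioo 0 t, ∫ r in Ioo 0 x, f r * (x - r) ^ b = ∫ r in (0 : ℝ)..x, g r := by
    intro x hx
    calc ∫ r in Ioo 0 x, f r * (x - r) ^ b
        = ((f 0 • H + (H ⋆ᵣ F)) ⋆ᵣ K) x := by
          rw [convolution_eq_setIntegral _ hK0]
          · refine setIntegral_congr_fun measurableSet_Ioo fun u hu => ?_
            rw [← hrep u ⟨hu.1, hu.2.trans hx.2⟩, hK,
              indicator_of_mem (show x - u ∈ Ioo 0 t from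
                  ⟨sub_pos.2 hu.2, by linarith [hu.1, hx.2]⟩)]
          · intro y hy
            simp [hH0 y hy, hHF0 y hy]
      _ = (H ⋆ᵣ g) x := by
          have e1 := convolutionExistsAt_of_bounded (M := |f 0|) (hHi.smul (f 0)).1
            (fun y => by
              simpa [abs_mul] using mul_le_mul_of_nonneg_left (hHb y) (abs_nonneg (f 0))) hKi x
          have e2 := convolutionExistsAt_of_bounded (hHi.integrable_convolution (mul ℝ ℝ) hFi).1
            (abs_convolution_le_of_bounded hHb hFi) hKi x
          have e3 := convolutionExistsAt_of_bounded hHi.1 hHb (hKi.smul (f 0)) x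
          have e4 := convolutionExistsAt_of_bounded hHi.1 hHb hFK x
          have ha := congrFun (convolution_assoc_of_bounded hHi hHb hFi hKi) x
          rw [e1.add_distrib e2, hg, e3.distrib_add e4, ha, smul_convolution, convolution_smul]
      _ = ∫ r in (0 : ℝ)..x, g r := by
          rw [convolution_mul_comm, convolution_eq_setIntegral hg0 hH0,
            intervalIntegral.integral_of_le hx.1.le, integral_Ioc_eq_integral_Ioo]
          refine setIntegral_congr_fun measurableSet_Ioo fun u hu => ?_
          simp only [hH]
          rw [indicator_of_mem (show x - u ∈ Ioo 0 t from
              ⟨sub_pos.2 hu.2, by linarith [hu.1, hx.2]⟩), mul_one]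
  have hcont : ContinuousAt g s := by
    refine ContinuousAt.add (continuousAt_const.mul ?_)
      (continuous_convolution_indicator_deriv hf ht hKi).continuousAt
    refine (Real.continuousAt_rpow_const s b (Or.inl hs.1.ne')).congr ?_
    filter_upwards [isOpen_Ioo.mem_nhds hs] with y hy
    rw [hK, indicator_of_mem hy]
  refine (intervalIntegral.integral_hasDerivAt_right (a := 0) hgi.intervalIntegrable
    hgi.1.stronglyMeasurableAtFilter hcont).congr_of_eventuallyEq ?_
  filter_upwards [isOpen_Ioo.mem_nhds hs] with y hy using key y hy

end ContDiffOn

/-- The kernel of order `1 - α` convolved with the derivative of order `α` of `f` gives back `f`. -/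
lemma convolution_fractional_deriv {f : ℝ → ℝ} {α t x : ℝ} (hf : ContDiffOn ℝ 1 f (Icc 0 t))
    (hα0 : 0 < α) (hα1 : α < 1) (hx : 0 < x) (hxt : x ≤ t) :
    ConvolutionExistsAt ((Ioo 0 t).indicator fun y : ℝ => y ^ (α - 1))
      ((f 0 • (Ioo 0 t).indicator fun y : ℝ => y ^ (-α)) +
        ((Ioo 0 t).indicator (deriv f) ⋆ᵣ (Ioo 0 t).indicator fun y : ℝ => y ^ (-α)))
      x (mul ℝ ℝ) volume ∧
    (((Ioo 0 t).indicator fun y : ℝ => y ^ (α - 1)) ⋆ᵣ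
      ((f 0 • (Ioo 0 t).indicator fun y : ℝ => y ^ (-α)) +
        ((Ioo 0 t).indicator (deriv f) ⋆ᵣ (Ioo 0 t).indicator fun y : ℝ => y ^ (-α)))) x
      = Real.Gamma α * Real.Gamma (1 - α) * f x := by
  have ht : 0 < t := hx.trans_le hxt
  have hKK : ∀ y : ℝ, 0 < y → y ≤ t → _ := fun y => convolution_indicator_rpow (t := t) hα0 hα1
  have hF0 : ∀ y ≤ 0, (Ioo 0 t).indicator (deriv f) y = 0 := indicator_Ioo_eq_zero _ t
  have hK0 : ∀ y ≤ 0, (Ioo 0 t).indicator (fun y : ℝ => y ^ (α - 1)) y = 0 :=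
    indicator_Ioo_eq_zero _ t
  have hL0 : ∀ y ≤ 0, (Ioo 0 t).indicator (fun y : ℝ => y ^ (-α)) y = 0 :=
    indicator_Ioo_eq_zero _ t
  have hKi := integrable_indicator_rpow (b := α - 1) (by linarith) t
  have hLi := integrable_indicator_rpow (b := -α) (by linarith) t
  have hFi := integrable_indicator_deriv hf ht
  obtain ⟨M, hM⟩ := exists_abs_indicator_deriv_le hf ht
  have hFx : ∀ u ∈ Ioo 0 x, (Ioo 0 t).indicator (deriv f) u = deriv f u := fun u hu =>
    indicator_of_mem (show u ∈ Ioo 0 t from ⟨hu.1, hu.2.trans_le hxt⟩) _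
  set F := (Ioo 0 t).indicator (deriv f)
  set K := (Ioo 0 t).indicator fun y : ℝ => y ^ (α - 1)
  set L := (Ioo 0 t).indicator fun y : ℝ => y ^ (-α)
  have hc := hKK x hx hxt
  have e1 : ConvolutionExistsAt K (f 0 • L) x (mul ℝ ℝ) volume := by
    have h : ConvolutionExistsAt K L x (mul ℝ ℝ) volume := by
      by_contra h
      have h0 : (K ⋆ᵣ L) x = 0 := integral_undef h
      rw [hc] at h0
      exact (mul_pos (Real.Gamma_pos_of_pos hα0) (Real.Gamma_pos_of_pos (sub_pos.2 hα1))).ne' h0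
    refine (Integrable.const_mul h (f 0)).congr (ae_of_all _ fun u => ?_)
    simp only [mul_apply', Pi.smul_apply, smul_eq_mul]
    ring
  have e2 : ConvolutionExistsAt K (F ⋆ᵣ L) x (mul ℝ ℝ) volume :=
    (hKi.mul_bdd ((hFi.integrable_convolution (mul ℝ ℝ) hLi).comp_sub_left x).1
      (ae_of_all _ fun u => abs_convolution_le_of_bounded hM hLi (x - u)))
  refine ⟨(Integrable.add e1 e2).congr (ae_of_all _ fun u =>
    ((mul ℝ ℝ (K u)).map_add _ _).symm), ?_⟩
  rw [e1.distrib_add e2, convolution_smul, Pi.smul_apply, hc, convolution_mul_comm K,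
    convolution_assoc_of_bounded hFi hM hLi hKi, convolution_mul_comm L,
    convolution_eq_setIntegral hF0 (convolution_eq_zero hK0 hL0)]
  have h : ∫ u in Ioo 0 x, F u * (K ⋆ᵣ L) (x - u) =
      ∫ u in Ioo 0 x, deriv f u * (Real.Gamma α * Real.Gamma (1 - α)) :=
    setIntegral_congr_fun measurableSet_Ioo fun u hu => by
      simp only [hFx u hu, hKK (x - u) (sub_pos.2 hu.2) (by linarith [hu.1])]
  rw [h, integral_mul_const, setIntegral_deriv_eq_sub hf hx hxt, smul_eq_mul]
  ring

end FractionalCalculus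

open FractionalCalculus ContinuousLinearMap in
/-- Fractional integration by parts for complementary orders `1-α` and `α`:
`∫₀ᵗ (D^{1-α}φ)(τ) (D^{α}ϕ)(t-τ) dτ = ∫₀ᵗ φ'(τ) ϕ(t-τ) dτ + φ(0)ϕ(t)`,
where `D^β` denotes the left Riemann–Liouville fractional derivative of order `β`. -/
theorem fractional_integration_by_parts (α t : ℝ) (hα0 : 0 < α) (hα1 : α < 1) (ht : 0 < t)
    (φ ϕ : ℝ → ℝ)
    (hφ : ContDiffOn ℝ 1 φ (Set.Icc 0 t)) (hϕ : ContDiffOn ℝ 1 ϕ (Set.Icc 0 t)) :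
    ∫ τ in Set.Ioo (0 : ℝ) t,
        ((1 / Real.Gamma α) *
          deriv (fun s : ℝ => ∫ r in Set.Ioo (0 : ℝ) s, φ r * (s - r) ^ (α - 1)) τ) *
        ((1 / Real.Gamma (1 - α)) *
          deriv (fun s : ℝ => ∫ r in Set.Ioo (0 : ℝ) s, ϕ r * (s - r) ^ (-α)) (t - τ)) =
      (∫ τ in Set.Ioo (0 : ℝ) t, deriv φ τ * ϕ (t - τ)) + φ 0 * ϕ t := by
  have hΓ1 := (Real.Gamma_pos_of_pos hα0).ne'
  have hΓ2 := (Real.Gamma_pos_of_pos (sub_pos.2 hα1)).ne'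
  have hinv : ∀ x : ℝ, 0 < x → x ≤ t → _ := fun x => convolution_fractional_deriv hϕ hα0 hα1
  have hdφ : ∀ s ∈ Set.Ioo 0 t, _ := fun s hs =>
    (hasDerivAt_fractional_integral hφ (b := α - 1) (by linarith) hs).deriv
  have hdϕ : ∀ s ∈ Set.Ioo 0 t, _ := fun s hs =>
    (hasDerivAt_fractional_integral hϕ (b := -α) (by linarith) hs).deriv
  have hP0 : ∀ y ≤ 0, (Set.Ioo 0 t).indicator (deriv φ) y = 0 := indicator_Ioo_eq_zero _ t
  have hF0 : ∀ y ≤ 0, (Set.Ioo 0 t).indicator (deriv ϕ) y = 0 := indicator_Ioo_eq_zero _ t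
  have hK0 : ∀ y ≤ 0, (Set.Ioo 0 t).indicator (fun y : ℝ => y ^ (α - 1)) y = 0 :=
    indicator_Ioo_eq_zero _ t
  have hL0 : ∀ y ≤ 0, (Set.Ioo 0 t).indicator (fun y : ℝ => y ^ (-α)) y = 0 :=
    indicator_Ioo_eq_zero _ t
  have hKi := integrable_indicator_rpow (b := α - 1) (by linarith) t
  have hLi := integrable_indicator_rpow (b := -α) (by linarith) t
  have hPi := integrable_indicator_deriv hφ ht
  have hFi := integrable_indicator_deriv hϕ ht
  obtain ⟨M, hM⟩ := exists_abs_indicator_deriv_le hφ ht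
  have hPx : ∀ u ∈ Set.Ioo 0 t, (Set.Ioo 0 t).indicator (deriv φ) u = deriv φ u := fun u hu =>
    Set.indicator_of_mem hu _
  set P := (Set.Ioo 0 t).indicator (deriv φ)
  set F := (Set.Ioo 0 t).indicator (deriv ϕ)
  set K := (Set.Ioo 0 t).indicator fun y : ℝ => y ^ (α - 1)
  set L := (Set.Ioo 0 t).indicator fun y : ℝ => y ^ (-α)
  have hPK0 := convolution_eq_zero hP0 hK0
  have hFL0 := convolution_eq_zero hF0 hL0
  have hPKi := hPi.integrable_convolution (mul ℝ ℝ) hKi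
  set D := ϕ 0 • L + convolution F L (mul ℝ ℝ) volume with hD
  have hD0 : ∀ y ≤ 0, D y = 0 := fun y hy => by simp [hD, hL0 y hy, hFL0 y hy]
  have hDi : Integrable D volume :=
    (hLi.smul (ϕ 0)).add (hFi.integrable_convolution _ hLi)
  have hG0 : ∀ y ≤ 0, (φ 0 • K + convolution P K (mul ℝ ℝ) volume) y = 0 := fun y hy => by
    simp [hK0 y hy, hPK0 y hy]
  have e2 := convolutionExistsAt_of_bounded hPKi.1 (abs_convolution_le_of_bounded hM hKi) hDi t
  have e1 : ConvolutionExistsAt (φ 0 • K) D t (mul ℝ ℝ) volume := by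
    refine (Integrable.const_mul (hinv t ht le_rfl).1 (φ 0)).congr (ae_of_all _ fun u => ?_)
    simp only [mul_apply', Pi.smul_apply, smul_eq_mul]
    ring
  have hPKD : convolution P (convolution K D (mul ℝ ℝ) volume) (mul ℝ ℝ) volume t =
      Real.Gamma α * Real.Gamma (1 - α) * ∫ u in Set.Ioo 0 t, deriv φ u * ϕ (t - u) := by
    rw [convolution_eq_setIntegral hP0 (convolution_eq_zero hK0 hD0), ← integral_const_mul]
    refine setIntegral_congr_fun measurableSet_Ioo fun u hu => ?_
    simp only [hPx u hu, (hinv (t - u) (sub_pos.2 hu.2) (by linarith [hu.1])).2]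
    ring
  calc _ = ∫ τ in Set.Ioo 0 t, (1 / (Real.Gamma α * Real.Gamma (1 - α))) *
        ((φ 0 • K + convolution P K (mul ℝ ℝ) volume) τ * D (t - τ)) := by
        refine setIntegral_congr_fun measurableSet_Ioo fun u hu => ?_
        simp only [hdφ u hu, hdϕ (t - u) ⟨sub_pos.2 hu.2, by linarith [hu.1]⟩]
        ring
    _ = _ := by
        rw [integral_const_mul, ← convolution_eq_setIntegral hG0 hD0, e1.add_distrib e2,
          smul_convolution, Pi.smul_apply, (hinv t ht le_rfl).2,
          convolution_assoc_of_bounded hPi hM hKi hDi, hPKD, smul_eq_mul]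
        field_simp
        ring
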